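/- Let C ⊆ A^n be a smooth irreducible algebraic curve which is not a line. Then ω(C) ≤ deg(C)(deg(C) − 1). -/

import Mathlib

open MvPolynomial

/-- A subset of affine space is an algebraic set if it is the zero locus of an
ideal of polynomials. -/
def IsAlgebraicSet {K : Type} [Field K] {n : ℕ} (W : Set (Fin n → K)) : Prop :=
  ∃ I : Ideal (MvPolynomial (Fin n) K), W = zeroLocus K I

/-- An irreducible affine variety: an algebraic set whose vanishing ideal is prime. -/
def IsIrreducibleVariety {K : Type} [Field K] {n : ℕ} (W : Set (Fin n → K)) : Prop :=
  IsAlgebraicSet W ∧ (vanishingIdeal K W).IsPrime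

/-- The dimension of an affine algebraic set: the Krull dimension of its coordinate ring. -/
noncomputable def varDim {K : Type} [Field K] {n : ℕ} (W : Set (Fin n → K)) : ℕ :=
  ENat.toNat ((ringKrullDim (MvPolynomial (Fin n) K ⧸ vanishingIdeal K W)).unbotD 0)

/-- The (Zariski) tangent space of `W` at `p`:
all `y` with `∇f(p)·y = 0` for every `f ∈ I(W)`. -/
def tangentSpaceAt {K : Type} [Field K] {n : ℕ} (W : Set (Fin n → K)) (p : Fin n → K) :
    Set (Fin n → K) :=
  {y | ∀ f ∈ vanishingIdeal K W, ∑ i, eval p (pderiv i f) * y i = 0}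

/-- The dimension of the tangent space at a point. -/
noncomputable def tangentDimAt {K : Type} [Field K] {n : ℕ} (W : Set (Fin n → K))
    (p : Fin n → K) : ℕ :=
  Module.finrank K (Submodule.span K (tangentSpaceAt W p))

/-- A point of an (irreducible) variety is a smooth point when the tangent space has
the dimension of the variety. -/
def IsSmoothAt {K : Type} [Field K] {n : ℕ} (W : Set (Fin n → K)) (p : Fin n → K) : Prop :=
  tangentDimAt W p = varDim W

/-- A variety is smooth if it is smooth at each of its points. -/
def IsSmoothVariety {K : Type} [Field K] {n : ℕ} (W : Set (Fin n → K)) : Prop :=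
  ∀ p ∈ W, IsSmoothAt W p

/-- Projection `A^{2n} → A^n` to the first `n` coordinates. -/
def fstProj {K : Type} {n : ℕ} (z : Fin (n + n) → K) : Fin n → K :=
  fun i => z (Fin.castAdd n i)

/-- Projection `A^{2n} → A^n` to the last `n` coordinates. -/
def sndProj {K : Type} {n : ℕ} (z : Fin (n + n) → K) : Fin n → K :=
  fun i => z (Fin.natAdd n i)

/-- The tangent bundle `TW ⊆ A^{2n}`: pairs `(x, y)` with `x ∈ W` and `y ∈ T_x W`. -/
def tangentBundle {K : Type} [Field K] {n : ℕ} (W : Set (Fin n → K)) :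
    Set (Fin (n + n) → K) :=
  {z | fstProj z ∈ W ∧ sndProj z ∈ tangentSpaceAt W (fstProj z)}

/-- Zariski closure of a subset of affine space. -/
def zclosure {K : Type} [Field K] {n : ℕ} (W : Set (Fin n → K)) : Set (Fin n → K) :=
  zeroLocus K (vanishingIdeal K W)

/-- The tangential variety `Tan(W)`: the Zariski closure of `π₂(TW)`. -/
def tangentialVariety {K : Type} [Field K] {n : ℕ} (W : Set (Fin n → K)) :
    Set (Fin n → K) :=
  zclosure (sndProj '' tangentBundle W)

/-- The geometric degree of an (irreducible) affine algebraic set: the maximal finite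
number of points in an intersection with an affine-linear subspace of complementary
dimension. -/
noncomputable def geomDegree {K : Type} [Field K] {n : ℕ} (W : Set (Fin n → K)) : ℕ :=
  sSup {m | ∃ L : AffineSubspace K (Fin n → K),
    Module.finrank K L.direction = n - varDim W ∧
    (W ∩ (L : Set (Fin n → K))).Finite ∧ (W ∩ (L : Set (Fin n → K))).ncard = m}

/-- A linear variety: an affine-linear subspace of affine space. -/
def IsLinearVariety {K : Type} [Field K] {n : ℕ} (W : Set (Fin n → K)) : Prop :=
  ∃ L : AffineSubspace K (Fin n → K), W = (L : Set (Fin n → K))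

/-- A line: an affine-linear subspace of dimension 1. -/
def IsLine {K : Type} [Field K] {n : ℕ} (W : Set (Fin n → K)) : Prop :=
  ∃ L : AffineSubspace K (Fin n → K), W = (L : Set (Fin n → K)) ∧
    Module.finrank K L.direction = 1

open Classical in
/-- `ω(C)`: the number of points in the fiber of `π₂ : TC → Tan(C)` over a generic
point of `Tan(C)`; it is `0` when `C` is a line. -/
noncomputable def omegaCurve {K : Type} [Field K] {n : ℕ} (C : Set (Fin n → K)) : ℕ :=
  if IsLine C then 0
  else sInf {m | ∃ Z : Set (Fin n → K), IsAlgebraicSet Z ∧ ¬ tangentialVariety C ⊆ Z ∧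
    ∀ v ∈ tangentialVariety C \ Z,
      {z ∈ tangentBundle C | sndProj z = v}.ncard = m}

/-- A smooth irreducible algebraic curve. -/
def IsSmoothCurve {K : Type} [Field K] {n : ℕ} (C : Set (Fin n → K)) : Prop :=
  IsIrreducibleVariety C ∧ varDim C = 1 ∧ IsSmoothVariety C

theorem aux_dim_integral {R S : Type*} [CommRing R] [CommRing S] [Algebra R S]
    [Algebra.IsIntegral R S] [FaithfulSMul R S] : ringKrullDim S = ringKrullDim R := by
  apply le_antisymm
  · refine Order.krullDim_le_of_strictMono (PrimeSpectrum.comap (algebraMap R S)) ?_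
    intro I J h
    exact Ideal.IsIntegral.comap_lt_comap (R := R) (I := I.asIdeal) (J := J.asIdeal) h
  · refine iSup_le fun l => ?_
    obtain ⟨⟨Q, hQ⟩, h⟩ := Algebra.IsIntegral.comap_surjective R S l.head
    have : Q.LiesOver (RelSeries.head l).asIdeal := ⟨by rw [← h]; rfl⟩
    obtain ⟨L, hL, -⟩ := Ideal.exists_ltSeries_of_hasGoingUp l Q
    rw [← hL]
    exact le_iSup (fun p : LTSeries (PrimeSpectrum S) => (p.length : WithBot ℕ∞)) L

theorem aux_noether {K A : Type} [Field K] [CommRing A] [IsDomain A] [Algebra K A]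
    [Algebra.FiniteType K A] (h : ringKrullDim A = 1) :
    ∃ g : Polynomial K →ₐ[K] A, Function.Injective g ∧ g.Finite := by
  obtain ⟨s, g, hg, hf⟩ := exists_finite_inj_algHom_of_fg K A
  have hs : s = 1 := by
    algebraize [g.toRingHom]
    have : FaithfulSMul (MvPolynomial (Fin s) K) A :=
      (faithfulSMul_iff_algebraMap_injective _ _).mpr hg
    have : Module.Finite (MvPolynomial (Fin s) K) A := hf
    have h1 := aux_dim_integral (R := MvPolynomial (Fin s) K) (S := A)
    rw [h, MvPolynomial.ringKrullDim_of_isNoetherianRing, ringKrullDim_eq_zero_of_field] at h1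
    simp at h1
    exact_mod_cast h1.symm
  subst hs
  let e : MvPolynomial (Fin 1) K ≃ₐ[K] Polynomial K := MvPolynomial.uniqueAlgEquiv K (Fin 1)
  refine ⟨g.comp e.symm.toAlgHom, hg.comp e.symm.injective, ?_⟩
  exact AlgHom.Finite.comp hf (AlgHom.Finite.of_surjective _ e.symm.surjective)

theorem aux_natDegree_det {K : Type*} [CommRing K] {r δ : ℕ} (M : Matrix (Fin r) (Fin r) (Polynomial K))
    (h : ∀ i j, (M i j).natDegree ≤ δ) : M.det.natDegree ≤ r * δ := by
  rw [Matrix.det_apply]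
  refine Polynomial.natDegree_sum_le_of_forall_le _ _ fun σ _ => ?_
  refine (Polynomial.natDegree_smul_le _ _).trans ?_
  refine (Polynomial.natDegree_prod_le _ _).trans ?_
  refine (Finset.sum_le_card_nsmul _ _ δ fun i _ => h _ _).trans ?_
  simp

theorem aux_dvd_norm {R A : Type*} [CommRing R] [CommRing A] [Algebra R A] {r : ℕ}
    (b : Module.Basis (Fin r) R A) (a : A) :
    a ∣ algebraMap R A (Algebra.leftMulMatrix b a).det := by
  have h0 : Polynomial.aeval a (Algebra.leftMulMatrix b a).charpoly = 0 := by
    apply Algebra.leftMulMatrix_injective b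
    rw [map_zero, ← Polynomial.aeval_algHom_apply, Matrix.aeval_self_charpoly]
  rw [Matrix.det_eq_sign_charpoly_coeff, map_mul]
  apply Dvd.dvd.mul_left
  have h1 := Polynomial.divX_mul_X_add (Algebra.leftMulMatrix b a).charpoly
  rw [← h1, map_add, map_mul, Polynomial.aeval_X, Polynomial.aeval_C] at h0
  rw [eq_neg_of_add_eq_zero_right h0, ← neg_mul]
  exact Dvd.intro_left _ rfl

theorem aux_bound {K A : Type} [Field K] [CommRing A] [IsDomain A] [Algebra K A]
    (g : Polynomial K →ₐ[K] A) (hg : Function.Injective g) (hf : g.Finite) {n : ℕ} (x : Fin n → A) :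
    ∃ N : ℕ, ∀ (c : Fin n → K) (b : K), ∑ i, c i • x i - algebraMap K A b ≠ 0 →
      ∀ T : Finset (Fin n → K), (∀ p ∈ T, ∃ φ : A →ₐ[K] K, (∀ i, φ (x i) = p i) ∧
        φ (∑ i, c i • x i - algebraMap K A b) = 0) → T.card ≤ N := by
  classical
  algebraize [g.toRingHom]
  have hfin : Module.Finite (Polynomial K) A := hf
  have hfa : FaithfulSMul (Polynomial K) A := (faithfulSMul_iff_algebraMap_injective _ _).mpr hg
  have htf : Module.IsTorsionFree (Polynomial K) A := inferInstance
  have hfree : Module.Free (Polynomial K) A := inferInstance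
  have hag : ∀ q, algebraMap (Polynomial K) A q = g q := fun q => rfl
  let B := Module.finBasis (Polynomial K) A
  set r := Module.finrank (Polynomial K) A
  let M : Fin n → Matrix (Fin r) (Fin r) (Polynomial K) := fun i => Algebra.leftMulMatrix B (x i)
  obtain ⟨δ, hδ⟩ : ∃ δ : ℕ, ∀ i j k, (M i j k).natDegree ≤ δ :=
    ⟨Finset.univ.sup fun i => Finset.univ.sup fun j => Finset.univ.sup fun k => (M i j k).natDegree,
      fun i j k => le_trans (le_trans (Finset.le_sup (f := fun k => (M i j k).natDegree) (Finset.mem_univ k))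
        (Finset.le_sup (f := fun j => Finset.univ.sup fun k => (M i j k).natDegree) (Finset.mem_univ j)))
        (Finset.le_sup (f := fun i => Finset.univ.sup fun j => Finset.univ.sup fun k => (M i j k).natDegree) (Finset.mem_univ i))⟩
  have hintg : ∀ i, ∃ P : Polynomial (Polynomial K), P.Monic ∧ P.eval₂ (algebraMap _ A) (x i) = 0 :=
    fun i => Algebra.IsIntegral.isIntegral (R := Polynomial K) (x i)
  choose P hPm hP using hintg
  refine ⟨(r * δ) * ∏ i, (P i).natDegree, fun c b hne T hT => ?_⟩
  set a := ∑ i, c i • x i - algebraMap K A b with ha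
  set d := (Algebra.leftMulMatrix B a).det with hd
  have hdne : d ≠ 0 := by
    rw [hd, ← Algebra.norm_eq_matrix_det]
    exact (Algebra.norm_ne_zero_iff).mpr hne
  have hdeg : d.natDegree ≤ r * δ := by
    apply aux_natDegree_det
    intro j k
    have h1 : algebraMap K A b = algebraMap (Polynomial K) A (Polynomial.C b) := by
      rw [hag]; exact (g.commutes b).symm
    have h2 : ∀ i, c i • x i = (Polynomial.C (c i)) • x i := by
      intro i
      rw [Algebra.smul_def, Algebra.smul_def, hag]
      congr 1
      exact (g.commutes (c i)).symm
    rw [ha, map_sub, map_sum, h1, AlgHom.commutes, Matrix.sub_apply, Matrix.sum_apply]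
    refine (Polynomial.natDegree_sub_le _ _).trans (max_le ?_ ?_)
    · refine Polynomial.natDegree_sum_le_of_forall_le _ _ fun i _ => ?_
      rw [h2, map_smul, Matrix.smul_apply, smul_eq_mul]
      exact (Polynomial.natDegree_C_mul_le _ _).trans (hδ i j k)
    · rw [Matrix.algebraMap_matrix_apply]
      split_ifs <;> simp
  have hsub : T ⊆ d.roots.toFinset.biUnion fun τ =>
      Fintype.piFinset fun i => ((P i).map (Polynomial.evalRingHom τ)).roots.toFinset := by
    intro p hp
    obtain ⟨φ, hφ, hφa⟩ := hT p hp
    have hev : ∀ q : Polynomial K, φ (algebraMap _ A q) = q.eval (φ (g Polynomial.X)) := by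
      intro q
      rw [hag]
      have : φ.comp g = Polynomial.aeval (φ (g Polynomial.X)) := by
        apply Polynomial.algHom_ext; simp
      have := DFunLike.congr_fun this q
      simpa [Polynomial.aeval_def] using this
    rw [Finset.mem_biUnion]
    refine ⟨φ (g Polynomial.X), ?_, ?_⟩
    · rw [Multiset.mem_toFinset, Polynomial.mem_roots hdne, Polynomial.IsRoot, ← hev]
      obtain ⟨e, he⟩ := aux_dvd_norm B a
      rw [he, map_mul, hφa, zero_mul]
    · rw [Fintype.mem_piFinset]
      intro i
      rw [Multiset.mem_toFinset, Polynomial.mem_roots ((hPm i).map _).ne_zero, Polynomial.IsRoot,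
        Polynomial.eval_map, ← hφ i]
      have h3 := congrArg φ (hP i)
      rw [map_zero] at h3
      rw [← h3]
      have h4 := Polynomial.hom_eval₂ (P i) (algebraMap (Polynomial K) A) (φ : A →+* K) (x i)
      refine Eq.trans ?_ h4.symm
      congr 1
      ext q <;> simp [hev]
  refine (Finset.card_le_card hsub).trans ?_
  refine (Finset.card_biUnion_le_card_mul _ _ (∏ i, (P i).natDegree) fun τ _ => ?_).trans ?_
  · rw [Fintype.card_piFinset]
    refine Finset.prod_le_prod' fun i _ => ?_
    refine (Multiset.toFinset_card_le _).trans ((Polynomial.card_roots' _).trans ?_)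
    exact Polynomial.natDegree_map_le
  · refine Nat.mul_le_mul_right _ ?_
    exact (Multiset.toFinset_card_le _).trans ((Polynomial.card_roots' _).trans hdeg)

theorem aux_finrank {K : Type*} [Field K] (k : ℕ) :
    2 * Module.finrank K (restrictTotalDegree (Fin 2) K k) = (k + 1) * (k + 2) := by
  classical
  have h1 : Module.finrank K (restrictTotalDegree (Fin 2) K k)
      = Nat.card {n : Fin 2 →₀ ℕ | (n.sum fun _ e => e) ≤ k} :=
    Module.finrank_eq_nat_card_basis (basisRestrictSupport K _)
  let S : Finset (ℕ × ℕ) := (Finset.range (k + 1)).biUnion fun i => Finset.HasAntidiagonal.antidiagonal i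
  let e : (Fin 2 →₀ ℕ) ≃ ℕ × ℕ := Finsupp.equivFunOnFinite.trans (finTwoArrowEquiv ℕ)
  have h2 : Nat.card {n : Fin 2 →₀ ℕ | (n.sum fun _ e => e) ≤ k} = Nat.card {x // x ∈ S} := by
    apply Nat.card_congr
    refine e.subtypeEquiv fun a => ?_
    have : (a.sum fun _ e => e) = a 0 + a 1 := by
      rw [Finsupp.sum_fintype _ _ (fun _ => rfl), Fin.sum_univ_two]
    simp [S, e, this, Nat.lt_succ_iff]
  have h3 : S.card = ∑ i ∈ Finset.range (k + 1), (i + 1) := by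
    rw [Finset.card_biUnion]
    · simp
    · intro i _ j _ hij
      rw [Function.onFun, Finset.disjoint_left]
      intro a ha hb
      rw [Finset.HasAntidiagonal.mem_antidiagonal] at ha hb
      exact hij (ha.symm.trans hb)
  rw [h1, h2, Nat.card_eq_fintype_card, Fintype.card_coe, h3]
  clear h1 h2 h3 S
  induction k with
  | zero => simp
  | succ m ih => rw [Finset.sum_range_succ, mul_add, ih]; ring

theorem aux_delta {K : Type*} [Field K] (T : Finset (Fin 2 → K)) (p : Fin 2 → K) :
    ∃ f : MvPolynomial (Fin 2) K, eval p f = 1 ∧ ∀ q ∈ T, q ≠ p → eval q f = 0 := by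
  classical
  have : ∀ q : Fin 2 → K, ∃ f : MvPolynomial (Fin 2) K, eval p f = 1 ∧ (q ≠ p → eval q f = 0) := by
    intro q
    by_cases h : q = p
    · exact ⟨1, by simp, fun h' => absurd h h'⟩
    · obtain ⟨i, hi⟩ := Function.ne_iff.mp h
      refine ⟨C (p i - q i)⁻¹ * (X i - C (q i)), ?_, fun _ => by simp⟩
      have : p i - q i ≠ 0 := sub_ne_zero.mpr (Ne.symm hi)
      simp [this]
  choose f h1 h2 using this
  refine ⟨∏ q ∈ T, f q, ?_, ?_⟩
  · rw [eval_prod]; exact Finset.prod_eq_one fun q _ => h1 q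
  · intro q hq hne
    rw [eval_prod]; exact Finset.prod_eq_zero hq (h2 q hne)

theorem aux_bezout {K : Type*} [Field K] (F G : MvPolynomial (Fin 2) K) (hF : Prime F)
    (hFG : ¬ F ∣ G) (T : Finset (Fin 2 → K))
    (hT : ∀ p ∈ T, eval p F = 0 ∧ eval p G = 0) :
    T.card ≤ F.totalDegree * G.totalDegree := by
  classical
  choose f hf1 hf2 using aux_delta T
  set a := F.totalDegree
  set b := G.totalDegree
  set N := T.sup fun p => (f p).totalDegree
  have hG0 : G ≠ 0 := fun h => hFG (h ▸ dvd_zero F)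
  have hF0 : F ≠ 0 := hF.ne_zero
  let P := fun k => restrictTotalDegree (Fin 2) K k
  -- evaluation
  let ev : P (a + b + N) →ₗ[K] (T → K) :=
    (LinearMap.pi fun p : T => (aeval (p : Fin 2 → K) : MvPolynomial (Fin 2) K →ₐ[K] K).toLinearMap) ∘ₗ
      (P (a + b + N)).subtype
  have hev : Function.Surjective ev := by
    intro y
    refine ⟨⟨∑ p : T, y p • f p, ?_⟩, ?_⟩
    · refine Submodule.sum_mem _ fun p _ => Submodule.smul_mem _ _ ?_
      rw [mem_restrictTotalDegree]
      exact (Finset.le_sup (f := fun p => (f p).totalDegree) p.2).trans (by omega)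
    · ext q
      simp only [ev, LinearMap.comp_apply, LinearMap.pi_apply, Submodule.subtype_apply,
        AlgHom.toLinearMap_apply, map_sum, map_smul, aeval_eq_eval]
      rw [Finset.sum_eq_single q]
      · simp [hf1]
      · intro p _ hpq
        simp [hf2 p q q.2 (fun h => hpq (Subtype.ext h.symm))]
      · simp
  let Φ : (P (b + N) × P (a + N)) →ₗ[K] MvPolynomial (Fin 2) K :=
    LinearMap.coprod ((LinearMap.mulLeft K F) ∘ₗ (P (b + N)).subtype)
      ((LinearMap.mulLeft K G) ∘ₗ (P (a + N)).subtype)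
  have hΦ : ∀ u, Φ u = F * u.1 + G * u.2 := fun u => rfl
  have hmem : ∀ u, Φ u ∈ P (a + b + N) := by
    intro u
    have h1 := (mem_restrictTotalDegree _ _ _).mp u.1.2
    have h2 := (mem_restrictTotalDegree _ _ _).mp u.2.2
    rw [hΦ, mem_restrictTotalDegree]
    refine (totalDegree_add _ _).trans (max_le ?_ ?_)
    · refine (totalDegree_mul _ _).trans ?_
      change a + _ ≤ _
      omega
    · refine (totalDegree_mul _ _).trans ?_
      change b + _ ≤ _
      omega
  let Ψ : (P (b + N) × P (a + N)) →ₗ[K] P (a + b + N) := LinearMap.codRestrict _ Φ hmem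
  have hrange : LinearMap.range Ψ ≤ LinearMap.ker ev := by
    rintro _ ⟨u, rfl⟩
    rw [LinearMap.mem_ker]
    ext q
    have h1 := (hT q q.2).1
    have h2 := (hT q q.2).2
    change aeval (q : Fin 2 → K) (Φ u) = 0
    rw [hΦ, aeval_eq_eval]
    simp [h1, h2]
  -- kernel
  let Θ : P N →ₗ[K] (MvPolynomial (Fin 2) K × MvPolynomial (Fin 2) K) :=
    LinearMap.prod (-(LinearMap.mulLeft K G) ∘ₗ (P N).subtype) ((LinearMap.mulLeft K F) ∘ₗ (P N).subtype)
  have hker : Module.finrank K (LinearMap.ker Ψ) ≤ Module.finrank K (P N) := by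
    let ι : LinearMap.ker Ψ →ₗ[K] (MvPolynomial (Fin 2) K × MvPolynomial (Fin 2) K) :=
      (LinearMap.prodMap (P (b + N)).subtype (P (a + N)).subtype) ∘ₗ (LinearMap.ker Ψ).subtype
    have hι : Function.Injective ι := by
      intro u v huv
      have h1 := congrArg Prod.fst huv
      have h2 := congrArg Prod.snd huv
      exact Subtype.ext (Prod.ext (Subtype.ext h1) (Subtype.ext h2))
    have hle : LinearMap.range ι ≤ LinearMap.range Θ := by
      rintro _ ⟨⟨⟨⟨u, hu⟩, ⟨v, hv⟩⟩, huv⟩, rfl⟩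
      have h0 : F * u + G * v = 0 := congrArg Subtype.val (LinearMap.mem_ker.mp huv)
      have hd : F ∣ G * v := ⟨-u, by linear_combination h0⟩
      obtain ⟨w, rfl⟩ := (hF.dvd_or_dvd hd).resolve_left hFG
      have hu' : u = -(G * w) := by
        apply mul_left_cancel₀ hF0
        linear_combination h0
      have hw : w ∈ P N := by
        rw [mem_restrictTotalDegree]
        by_cases hw0 : w = 0
        · simp [hw0]
        · have := (mem_restrictTotalDegree _ _ _).mp hv
          rw [totalDegree_mul_of_isDomain hF0 hw0] at this
          change a + _ ≤ _ at this
          omega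
      refine ⟨⟨w, hw⟩, ?_⟩
      change (-(G * w), F * w) = (u, F * w)
      rw [hu']
    have hfd : Module.Finite K (P N) := inferInstanceAs (Module.Finite K (restrictTotalDegree (Fin 2) K N))
    calc Module.finrank K (LinearMap.ker Ψ) = Module.finrank K (LinearMap.range ι) :=
          (LinearMap.finrank_range_of_inj hι).symm
      _ ≤ Module.finrank K (LinearMap.range Θ) := Submodule.finrank_mono hle
      _ ≤ _ := LinearMap.finrank_range_le _
  have hfd : ∀ k, Module.Finite K (P k) := fun k => inferInstanceAs (Module.Finite K (restrictTotalDegree (Fin 2) K k))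
  have e1 := LinearMap.finrank_range_add_finrank_ker Ψ
  have e2 := LinearMap.finrank_range_add_finrank_ker ev
  have e3 := Submodule.finrank_mono hrange
  rw [LinearMap.range_eq_top.mpr hev, finrank_top] at e2
  rw [Module.finrank_prod] at e1
  have e4 : Module.finrank K (T → K) = T.card := by simp
  rw [e4] at e2
  have f1 : 2 * Module.finrank K (P (a + b + N)) = _ := aux_finrank (K := K) (a + b + N)
  have f2 : 2 * Module.finrank K (P (b + N)) = _ := aux_finrank (K := K) (b + N)
  have f3 : 2 * Module.finrank K (P (a + N)) = _ := aux_finrank (K := K) (a + N)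
  have f4 : 2 * Module.finrank K (P N) = _ := aux_finrank (K := K) N
  nlinarith

theorem aux_chain {K S : Type*} [Field K] [CommRing S] [Algebra K S] {m : ℕ} (y : Fin m → S)
    (D : Derivation K S S) (F : MvPolynomial (Fin m) K) :
    D (aeval y F) = ∑ j, aeval y (pderiv j F) * D (y j) := by
  induction F using MvPolynomial.induction_on with
  | C a => simp
  | add p q hp hq => simp only [map_add, hp, hq, add_mul, Finset.sum_add_distrib]
  | mul_X p i hp =>
    rw [map_mul, Derivation.leibniz, hp, aeval_X]
    simp only [Derivation.leibniz, pderiv_X, smul_eq_mul, map_add, map_mul, aeval_X, add_mul,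
      Finset.sum_add_distrib, Finset.mul_sum]
    congr 1
    · rw [Finset.sum_eq_single i]
      · simp
      · intro j _ hj; simp [Pi.single_apply, hj, Ne.symm hj]
      · simp
    · exact Finset.sum_congr rfl fun j _ => by ring

theorem aux_pderiv_deg {K : Type*} [Field K] {m : ℕ} (F : MvPolynomial (Fin m) K) (i : Fin m) :
    (pderiv i F).totalDegree ≤ F.totalDegree - 1 := by
  conv_lhs => rw [F.as_sum, map_sum]
  refine totalDegree_finsetSum_le fun s hs => ?_
  rw [pderiv_monomial]
  by_cases h : s i = 0
  · simp [h]
  · refine (totalDegree_monomial_le _ _).trans ?_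
    have h1 := le_totalDegree hs
    rw [Finsupp.sum_fintype _ _ (fun _ => rfl)] at h1 ⊢
    have h2 : ∑ j, (s - Finsupp.single i 1 : Fin m →₀ ℕ) j + 1 = ∑ j, s j := by
      rw [← Finset.sum_erase_add Finset.univ (fun j => (s - Finsupp.single i 1 : Fin m →₀ ℕ) j) (Finset.mem_univ i),
        ← Finset.sum_erase_add Finset.univ (fun j => s j) (Finset.mem_univ i)]
      have : ∑ x ∈ Finset.univ.erase i, (s - Finsupp.single i 1 : Fin m →₀ ℕ) x = ∑ x ∈ Finset.univ.erase i, s x := by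
        refine Finset.sum_congr rfl fun j hj => ?_
        have := Finset.ne_of_mem_erase hj
        simp [Finsupp.single_apply, Ne.symm this]
      rw [this]
      simp
      omega
    simp only [id]
    omega

theorem aux_line_deg {K : Type*} [Field K] (F : MvPolynomial (Fin 2) K) (u a : Fin 2 → K) :
    (aeval (fun i => Polynomial.C (a i) + Polynomial.C (u i) * Polynomial.X) F : Polynomial K).natDegree
      ≤ F.totalDegree ∧
    (aeval (fun i => Polynomial.C (a i) + Polynomial.C (u i) * Polynomial.X) F : Polynomial K).coeff
      F.totalDegree = eval u (homogeneousComponent F.totalDegree F) := by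
  classical
  have hl : ∀ i, (Polynomial.C (a i) + Polynomial.C (u i) * Polynomial.X : Polynomial K).natDegree ≤ 1 := by
    intro i
    refine (Polynomial.natDegree_add_le _ _).trans (max_le (by simp) ?_)
    exact (Polynomial.natDegree_C_mul_le _ _).trans Polynomial.natDegree_X_le
  have hp : ∀ i (e : ℕ), ((Polynomial.C (a i) + Polynomial.C (u i) * Polynomial.X : Polynomial K) ^ e).natDegree ≤ e := by
    intro i e
    refine Polynomial.natDegree_pow_le.trans ?_
    calc e * _ ≤ e * 1 := Nat.mul_le_mul_left _ (hl i)
      _ = e := mul_one e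
  have hpc : ∀ i (e : ℕ), ((Polynomial.C (a i) + Polynomial.C (u i) * Polynomial.X : Polynomial K) ^ e).coeff e = u i ^ e := by
    intro i e
    have := Polynomial.coeff_pow_of_natDegree_le (m := e) (hl i)
    simpa using this
  have hterm : ∀ (s : Fin 2 →₀ ℕ) (c : K), (algebraMap K (Polynomial K) c *
      ∏ i, (Polynomial.C (a i) + Polynomial.C (u i) * Polynomial.X : Polynomial K) ^ s i).natDegree ≤ s 0 + s 1 := by
    intro s c
    rw [Fin.prod_univ_two]
    refine (Polynomial.natDegree_C_mul_le _ _).trans (Polynomial.natDegree_mul_le.trans ?_)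
    exact add_le_add (hp _ _) (hp _ _)
  have htermc : ∀ (s : Fin 2 →₀ ℕ) (c : K), (algebraMap K (Polynomial K) c *
      ∏ i, (Polynomial.C (a i) + Polynomial.C (u i) * Polynomial.X : Polynomial K) ^ s i).coeff (s 0 + s 1)
        = c * (u 0 ^ s 0 * u 1 ^ s 1) := by
    intro s c
    rw [Fin.prod_univ_two]
    erw [Polynomial.coeff_C_mul]
    rw [Polynomial.coeff_mul_add_eq_of_natDegree_le (hp _ _) (hp _ _), hpc, hpc]
  have hdeg : ∀ s ∈ F.support, s 0 + s 1 ≤ F.totalDegree := by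
    intro s hs
    have := le_totalDegree hs
    rwa [Finsupp.sum_fintype _ _ (fun _ => rfl), Fin.sum_univ_two] at this
  constructor
  · rw [aeval_def, eval₂_eq']
    exact Polynomial.natDegree_sum_le_of_forall_le _ _ fun s hs => (hterm _ _).trans (hdeg s hs)
  · rw [aeval_def, eval₂_eq', Polynomial.finsetSum_coeff, homogeneousComponent_apply, map_sum,
      Finset.sum_filter]
    refine Finset.sum_congr rfl fun s hs => ?_
    have hd : s.degree = s 0 + s 1 := by rw [Finsupp.degree_eq_sum, Fin.sum_univ_two]
    split_ifs with h
    · rw [← h, hd, htermc, eval_monomial, Finsupp.prod_fintype _ _ (by simp), Fin.prod_univ_two]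
    · apply Polynomial.coeff_eq_zero_of_natDegree_lt
      have h1 := hterm s (coeff s F)
      have h2 := hdeg s hs
      rw [hd] at h
      omega

theorem aux_finite {K : Type*} [Field K] (F G : MvPolynomial (Fin 2) K) (hF : Prime F)
    (hFG : ¬ F ∣ G) : {p : Fin 2 → K | eval p F = 0 ∧ eval p G = 0}.Finite := by
  by_contra h
  obtain ⟨t, ht, hc⟩ := (show Set.Infinite _ from h).exists_subset_card_eq
    (F.totalDegree * G.totalDegree + 1)
  have := aux_bezout F G hF hFG t (fun p hp => ht hp)
  omega

theorem aux_dvd_deg {K : Type*} [Field K] (F G : MvPolynomial (Fin 2) K) (hF : Prime F)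
    (hG : G ≠ 0) (h : G.totalDegree < F.totalDegree) : ¬ F ∣ G := by
  rintro ⟨q, rfl⟩
  rw [totalDegree_mul_of_isDomain hF.ne_zero (right_ne_zero_of_mul hG)] at h
  omega

theorem aux_prime_deg {K : Type*} [Field K] (F : MvPolynomial (Fin 2) K) (hF : Prime F) :
    1 ≤ F.totalDegree := by
  by_contra h
  have h0 : F.totalDegree = 0 := by omega
  rw [totalDegree_eq_zero_iff_eq_C] at h0
  apply hF.not_isUnit
  rw [h0]
  refine IsUnit.map _ (isUnit_iff_ne_zero.mpr fun hc => hF.ne_zero ?_)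
  rw [h0, hc, C_0]

theorem aux_line {K : Type*} [Field K] [IsAlgClosed K] [CharZero K]
    (F H : MvPolynomial (Fin 2) K) (hF : Prime F) (hFH : ¬ F ∣ H) :
    ∃ (u : Fin 2 → K) (γ : K),
      {p : Fin 2 → K | eval p F = 0 ∧ u 1 * p 0 - u 0 * p 1 = γ}.Finite ∧
      ∃ T : Finset (Fin 2 → K), T.card = F.totalDegree ∧
        ∀ p ∈ T, eval p F = 0 ∧ eval p H ≠ 0 ∧ u 1 * p 0 - u 0 * p 1 = γ := by
  classical
  have hd1 := aux_prime_deg F hF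
  set d := F.totalDegree with hd
  -- direction
  obtain ⟨u, hu⟩ : ∃ u : Fin 2 → K, eval u (homogeneousComponent d F) ≠ 0 := by
    by_contra! hcon
    have h0 : homogeneousComponent d F = 0 := MvPolynomial.funext (by simpa using hcon)
    obtain ⟨s, hs, hsd⟩ := Finset.exists_mem_eq_sup F.support (support_nonempty.mpr hF.ne_zero)
      (fun s => s.sum fun _ e => e)
    have h1 : coeff s (homogeneousComponent d F) = coeff s F := by
      rw [coeff_homogeneousComponent, if_pos]
      rw [hd, totalDegree, hsd, Finsupp.degree_apply]; rfl
    rw [h0, coeff_zero] at h1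
    exact (mem_support_iff.mp hs) h1.symm
  have hu0 : u ≠ 0 := by
    rintro rfl
    apply hu
    have h2 : coeff 0 (homogeneousComponent d F) = 0 := by
      rw [coeff_homogeneousComponent, if_neg]
      simp; omega
    rw [← h2, ← constantCoeff_eq]
    rw [MvPolynomial.eval_zero]
  let f : (Fin 2 → K) → Polynomial K := fun a =>
    aeval (fun i => Polynomial.C (a i) + Polynomial.C (u i) * Polynomial.X) F
  have hfdeg : ∀ a, (f a).natDegree = d := by
    intro a
    obtain ⟨h1, h2⟩ := aux_line_deg F u a
    apply le_antisymm h1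
    apply Polynomial.le_natDegree_of_ne_zero
    rw [h2]; exact hu
  have heval : ∀ (G : MvPolynomial (Fin 2) K) (a : Fin 2 → K) (l : K),
      (aeval (fun i => Polynomial.C (a i) + Polynomial.C (u i) * Polynomial.X) G : Polynomial K).eval l
        = eval (a + l • u) G := by
    intro G a l
    have : ((Polynomial.aeval l).comp (aeval (fun i => Polynomial.C (a i) + Polynomial.C (u i) * Polynomial.X) :
        MvPolynomial (Fin 2) K →ₐ[K] Polynomial K)) = aeval (a + l • u) := by
      apply MvPolynomial.algHom_ext
      intro i
      rw [AlgHom.comp_apply, aeval_X, aeval_X]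
      simp only [map_add, map_mul, Polynomial.aeval_C, Polynomial.aeval_X, Pi.add_apply, Pi.smul_apply, smul_eq_mul, Algebra.algebraMap_self, RingHom.id_apply]
      ring
    have := DFunLike.congr_fun this G
    rw [AlgHom.comp_apply, Polynomial.coe_aeval_eq_eval, aeval_eq_eval] at this
    exact this
  let Du : MvPolynomial (Fin 2) K := ∑ j, C (u j) * pderiv j F
  have hder : ∀ a, Polynomial.derivative (f a) =
      aeval (fun i => Polynomial.C (a i) + Polynomial.C (u i) * Polynomial.X) Du := by
    intro a
    have := aux_chain (fun i => Polynomial.C (a i) + Polynomial.C (u i) * Polynomial.X)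
      (Polynomial.derivative' (R := K)) F
    simp only [Polynomial.derivative'_apply] at this
    rw [this]
    simp only [Du, map_sum, map_mul, aeval_C]
    refine Finset.sum_congr rfl fun j _ => ?_
    rw [mul_comm]
    congr 1
    simp
  have hDu0 : Du ≠ 0 := by
    intro h
    have h1 := hder 0
    rw [h, map_zero] at h1
    have h2 := Polynomial.derivative_eq_zero.mp h1
    rw [hfdeg] at h2
    omega
  have hDud : Du.totalDegree < d := by
    refine lt_of_le_of_lt (b := d - 1) ?_ (by omega)
    refine totalDegree_finsetSum_le fun j _ => ?_
    refine (totalDegree_mul _ _).trans ?_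
    rw [totalDegree_C, zero_add]
    exact aux_pderiv_deg F j
  have hE := (aux_finite F Du hF (aux_dvd_deg F Du hF hDu0 hDud)).union (aux_finite F H hF hFH)
  let η : (Fin 2 → K) → K := fun p => u 1 * p 0 - u 0 * p 1
  obtain ⟨γ, hγ⟩ := (hE.image η).exists_notMem
  obtain ⟨a, ha⟩ : ∃ a : Fin 2 → K, η a = γ := by
    by_cases h0 : u 0 = 0
    · have h1 : u 1 ≠ 0 := by
        intro h1
        apply hu0
        ext i; fin_cases i <;> simp [h0, h1]
      exact ⟨![γ / u 1, 0], by simp [η]; field_simp⟩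
    · exact ⟨![0, -γ / u 0], by simp [η]; field_simp⟩
  have hηl : ∀ l : K, η (a + l • u) = γ := by
    intro l
    rw [← ha]; simp [η]; ring
  have hf0 : f a ≠ 0 := by
    intro h
    have := hfdeg a
    rw [h, Polynomial.natDegree_zero] at this
    omega
  have hinj : Function.Injective fun l : K => a + l • u := by
    intro l l' h
    have h1 : l • u = l' • u := add_left_cancel h
    exact smul_left_injective K hu0 h1
  refine ⟨u, γ, ?_, (f a).roots.toFinset.image (fun l => a + l • u), ?_, ?_⟩
  · refine (((f a).roots.toFinset.finite_toSet).image (fun l => a + l • u)).subset ?_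
    rintro p ⟨hp1, hp2⟩
    have hp3 : u 1 * (p 0 - a 0) = u 0 * (p 1 - a 1) := by
      have : u 1 * a 0 - u 0 * a 1 = γ := ha
      linear_combination hp2 - this
    have : ∃ l : K, p = a + l • u := by
      by_cases h0 : u 0 = 0
      · have h1 : u 1 ≠ 0 := by
          intro h1
          apply hu0
          ext i; fin_cases i <;> simp [h0, h1]
        refine ⟨(p 1 - a 1) / u 1, ?_⟩
        rw [h0, zero_mul, mul_eq_zero, or_iff_right h1, sub_eq_zero] at hp3
        ext i
        fin_cases i
        · simp [h0, hp3]
        · simp; field_simp; ring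
      · refine ⟨(p 0 - a 0) / u 0, ?_⟩
        ext i
        fin_cases i
        · simp; field_simp; ring
        · simp; field_simp; linear_combination -hp3
    obtain ⟨l, rfl⟩ := this
    refine ⟨l, ?_, rfl⟩
    rw [Finset.mem_coe, Multiset.mem_toFinset, Polynomial.mem_roots hf0, Polynomial.IsRoot]
    exact (heval F a l).trans hp1
  · rw [Finset.card_image_of_injective _ hinj, Multiset.toFinset_card_of_nodup]
    · rw [← (IsAlgClosed.splits (f a)).natDegree_eq_card_roots, hfdeg]
    · rw [Multiset.nodup_iff_count_le_one]
      intro l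
      rw [Polynomial.count_roots]
      by_contra hcon
      rw [not_le, Polynomial.one_lt_rootMultiplicity_iff_isRoot hf0] at hcon
      obtain ⟨h2, h1⟩ := hcon
      rw [hder] at h1
      apply hγ
      refine ⟨a + l • u, Or.inl ⟨?_, ?_⟩, hηl l⟩
      · exact (heval F a l).symm.trans h2
      · exact (heval Du a l).symm.trans h1
  · intro p hp
    obtain ⟨l, hl, rfl⟩ := Finset.mem_image.mp hp
    rw [Multiset.mem_toFinset, Polynomial.mem_roots hf0] at hl
    have h1 : eval (a + l • u) F = 0 := (heval F a l).symm.trans hl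
    refine ⟨h1, fun h2 => hγ ⟨a + l • u, Or.inr ⟨h1, h2⟩, hηl l⟩, hηl l⟩

theorem aux_point {K A : Type} [Field K] [IsAlgClosed K] [CommRing A] [Algebra K A]
    [Algebra.FiniteType K A] (J : Ideal A) (hJ : J.IsMaximal) :
    ∃ φ : A →ₐ[K] K, ∀ a ∈ J, φ a = 0 := by
  letI : Field (A ⧸ J) := Ideal.Quotient.field J
  haveI : Module.Finite K (A ⧸ J) := finite_of_finite_type_of_isJacobsonRing K (A ⧸ J)
  let e : K ≃ₐ[K] (A ⧸ J) := AlgEquiv.ofBijective (Algebra.ofId K (A ⧸ J))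
    IsAlgClosed.algebraMap_bijective_of_isIntegral
  refine ⟨e.symm.toAlgHom.comp (Ideal.Quotient.mkₐ K J), fun a ha => ?_⟩
  have : Ideal.Quotient.mkₐ K J a = 0 := Ideal.Quotient.eq_zero_iff_mem.mpr ha
  rw [AlgHom.comp_apply, this, map_zero]

theorem aux_lift {K A R : Type} [Field K] [IsAlgClosed K] [CommRing A] [Algebra K A]
    [CommRing R] [Algebra K R] [Algebra R A] [IsScalarTower K R A]
    {n : ℕ} (x : Fin n → A) (hx : Algebra.adjoin K (Set.range x) = ⊤)
    (ψ : R →ₐ[K] K) (hker : ∀ r : R, algebraMap R A r = 0 → ψ r = 0)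
    (h : R) (hh : ψ h ≠ 0) (hintg : ∀ i, IsIntegral R (h • x i)) :
    ∃ φ : A →ₐ[K] K, ∀ r : R, φ (algebraMap R A r) = ψ r := by
  have hft : Algebra.FiniteType K A := by
    refine ⟨⟨(Set.finite_range x).toFinset, ?_⟩⟩
    simpa using hx
  have c1 : ∀ a : A, ∃ N : ℕ, IsIntegral R (h ^ N • a) := by
    intro a
    have ha : a ∈ Algebra.adjoin K (Set.range x) := by rw [hx]; trivial
    induction ha using Algebra.adjoin_induction with
    | mem a ha =>
      obtain ⟨i, rfl⟩ := ha
      exact ⟨1, by simpa using hintg i⟩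
    | algebraMap c =>
      refine ⟨0, ?_⟩
      rw [IsScalarTower.algebraMap_apply K R A, pow_zero, one_smul]
      exact isIntegral_algebraMap
    | add a b _ _ iha ihb =>
      obtain ⟨N, hN⟩ := iha
      obtain ⟨M, hM⟩ := ihb
      refine ⟨N + M, ?_⟩
      have : h ^ (N + M) • (a + b) = h ^ M • (h ^ N • a) + h ^ N • (h ^ M • b) := by
        rw [smul_smul, smul_smul, ← pow_add, ← pow_add, smul_add, add_comm M N]
      rw [this]
      exact (hN.smul _).add (hM.smul _)
    | mul a b _ _ iha ihb =>
      obtain ⟨N, hN⟩ := iha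
      obtain ⟨M, hM⟩ := ihb
      refine ⟨N + M, ?_⟩
      have : h ^ (N + M) • (a * b) = (h ^ N • a) * (h ^ M • b) := by
        rw [smul_mul_smul_comm, pow_add]
      rw [this]
      exact hN.mul hM
  let m : Ideal R := RingHom.ker ψ
  haveI hm : m.IsMaximal := RingHom.ker_isMaximal_of_surjective ψ
    (fun c => ⟨algebraMap K R c, by simp⟩)
  let A₀ := integralClosure R A
  have hkl : RingHom.ker (algebraMap R A₀) ≤ m := by
    intro r hr
    rw [RingHom.mem_ker] at hr
    apply hker
    rw [IsScalarTower.algebraMap_apply R A₀ A, hr, map_zero]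
  obtain ⟨M, hM, hMm⟩ := Ideal.exists_ideal_over_maximal_of_isIntegral (S := A₀) m hkl
  have c2 : ∀ a ∈ m.map (algebraMap R A), ∃ N : ℕ, ∃ y : A₀, y ∈ M ∧ (y : A) = h ^ N • a := by
    intro a ha
    refine Submodule.span_induction (p := fun a _ => ∃ N : ℕ, ∃ y : A₀, y ∈ M ∧ (y : A) = h ^ N • a)
      ?_ ?_ ?_ ?_ ha
    · rintro _ ⟨r, hr, rfl⟩
      refine ⟨0, algebraMap R A₀ r, ?_, ?_⟩
      · have : r ∈ M.comap (algebraMap R A₀) := by rw [hMm]; exact hr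
        exact this
      · rw [pow_zero, one_smul]; rfl
    · exact ⟨0, 0, M.zero_mem, by simp⟩
    · rintro a b _ _ ⟨N, y, hy, hya⟩ ⟨N', y', hy', hya'⟩
      refine ⟨N + N', h ^ N' • y + h ^ N • y', ?_, ?_⟩
      · refine M.add_mem ?_ ?_
        · rw [Algebra.smul_def]; exact M.mul_mem_left _ hy
        · rw [Algebra.smul_def]; exact M.mul_mem_left _ hy'
      · push_cast
        rw [hya, hya', smul_smul, smul_smul, ← pow_add, ← pow_add, smul_add, add_comm N' N]
    · rintro a b _ ⟨N, y, hy, hya⟩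
      obtain ⟨N', hN'⟩ := c1 a
      refine ⟨N' + N, ⟨_, hN'⟩ * y, M.mul_mem_left _ hy, ?_⟩
      push_cast
      rw [hya, smul_mul_smul_comm, pow_add, smul_eq_mul]
  have hne : m.map (algebraMap R A) ≠ ⊤ := by
    intro htop
    obtain ⟨N, y, hy, hya⟩ := c2 1 (by rw [htop]; trivial)
    have : y = algebraMap R A₀ (h ^ N) := by
      apply Subtype.ext
      rw [hya, Algebra.smul_def, mul_one]; rfl
    rw [this] at hy
    have h2 : h ^ N ∈ M.comap (algebraMap R A₀) := hy
    rw [hMm] at h2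
    have h3 : ψ (h ^ N) = 0 := h2
    rw [map_pow] at h3
    exact pow_ne_zero N hh h3
  obtain ⟨J, hJ, hmJ⟩ := Ideal.exists_le_maximal _ hne
  obtain ⟨φ, hφ⟩ := aux_point (K := K) J hJ
  refine ⟨φ, fun r => ?_⟩
  have h4 : r - algebraMap K R (ψ r) ∈ m := by
    rw [RingHom.mem_ker]; simp
  have h5 := hφ _ (hmJ (Ideal.mem_map_of_mem _ h4))
  rw [map_sub, ← IsScalarTower.algebraMap_apply, map_sub, AlgHom.commutes, sub_eq_zero] at h5
  exact h5

theorem aux_trdeg {K A : Type} [Field K] [CommRing A] [IsDomain A] [Algebra K A]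
    (g : Polynomial K →ₐ[K] A) (hg : Function.Injective g) (hf : g.Finite) :
    Algebra.trdeg K A = 1 := by
  letI : Algebra (Polynomial K) A := g.toRingHom.toAlgebra
  haveI : IsScalarTower K (Polynomial K) A := IsScalarTower.of_algebraMap_eq fun c =>
    (g.commutes c).symm
  haveI : FaithfulSMul (Polynomial K) A := (faithfulSMul_iff_algebraMap_injective _ _).mpr hg
  haveI : Module.Finite (Polynomial K) A := hf
  have h0 : Algebra.trdeg (Polynomial K) A = 0 := trdeg_eq_zero
  have := trdeg_add_eq K (Polynomial K) (A := A)
  rw [h0, Polynomial.trdeg_of_isDomain, add_zero] at this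
  exact this.symm

theorem aux_integral {K A : Type} [Field K] [CommRing A] [IsDomain A] [Algebra K A]
    (htr : Algebra.trdeg K A = 1) {n : ℕ} (x : Fin n → A) (w : A) (hw : Transcendental K w) :
    letI : Algebra (Polynomial K) A := (Polynomial.aeval w).toRingHom.toAlgebra
    ∃ h : Polynomial K, h ≠ 0 ∧ ∀ i, IsIntegral (Polynomial K) (h • x i) := by
  letI : Algebra (Polynomial K) A := (Polynomial.aeval w).toRingHom.toAlgebra
  haveI : IsScalarTower K (Polynomial K) A := IsScalarTower.of_algebraMap_eq fun c =>
    ((Polynomial.aeval w).commutes c).symm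
  haveI : FaithfulSMul (Polynomial K) A := (faithfulSMul_iff_algebraMap_injective _ _).mpr
    (transcendental_iff_injective.mp hw)
  have h1 := trdeg_add_eq K (Polynomial K) (A := A)
  rw [htr, Polynomial.trdeg_of_isDomain] at h1
  have h0 : Algebra.trdeg (Polynomial K) A = 0 := by
    have h2 : (1 : Cardinal) + Algebra.trdeg (Polynomial K) A = 1 + 0 := by rw [h1, add_zero]
    exact Cardinal.eq_of_add_eq_add_left h2 Cardinal.one_lt_aleph0
  have halg := trdeg_eq_zero_iff.mp h0
  have := fun i => (halg.isAlgebraic (x i)).exists_integral_multiple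
  choose y hy hyi using this
  refine ⟨∏ i, y i, Finset.prod_ne_zero_iff.mpr fun i _ => hy i, fun i => ?_⟩
  rw [← Finset.prod_erase_mul _ _ (Finset.mem_univ i), mul_smul]
  exact (hyi i).smul _

theorem aux_inf {K A : Type} [Field K] [IsAlgClosed K] [CommRing A] [IsDomain A] [Algebra K A]
    (htr : Algebra.trdeg K A = 1) {n : ℕ} (x : Fin n → A)
    (hx : Algebra.adjoin K (Set.range x) = ⊤) (w : A) (hw : Transcendental K w) :
    {c : K | ∃ φ : A →ₐ[K] K, φ w = c}.Infinite := by
  obtain ⟨h, hh, hi⟩ := aux_integral htr x w hw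
  letI : Algebra (Polynomial K) A := (Polynomial.aeval w).toRingHom.toAlgebra
  haveI : IsScalarTower K (Polynomial K) A := IsScalarTower.of_algebraMap_eq fun c =>
    ((Polynomial.aeval w).commutes c).symm
  have hinj : Function.Injective (algebraMap (Polynomial K) A) :=
    transcendental_iff_injective.mp hw
  have hfin : {c : K | h.eval c = 0}.Finite := by
    classical
    refine (h.roots.toFinset.finite_toSet).subset fun c hc => ?_
    simpa [hh] using hc
  refine hfin.infinite_compl.mono fun c hc => ?_
  obtain ⟨φ, hφ⟩ := aux_lift x hx (Polynomial.aeval c) (fun r hr => by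
    rw [(map_eq_zero_iff _ hinj).mp hr, map_zero]) h (by simpa using hc) hi
  refine ⟨φ, ?_⟩
  have := hφ Polynomial.X
  rw [Polynomial.aeval_X] at this
  rw [← this]
  congr 1
  exact (Polynomial.aeval_X w).symm

theorem aux_pderiv_ne {K A : Type} [Field K] [CharZero K] [CommRing A] [IsDomain A] [Algebra K A]
    (s w : A) (hw : Transcendental K w) (F : MvPolynomial (Fin 2) K) (hF : F ≠ 0)
    (hFz : aeval ![s, w] F = 0) : pderiv 0 F ≠ 0 := by
  intro h
  have hv : ∀ m ∈ F.support, m 0 = 0 := by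
    intro m hm
    by_contra hm0
    have h1 := coeff_pderiv (i := 0) F (m - Finsupp.single 0 1)
    have h2 : m - Finsupp.single 0 1 + Finsupp.single 0 1 = m := by
      apply tsub_add_cancel_of_le
      rw [Finsupp.single_le_iff]; omega
    rw [h, coeff_zero, h2] at h1
    have h3 := mul_eq_zero.mp h1.symm
    rcases h3 with h3 | h3
    · exact (mem_support_iff.mp hm) h3
    · have : (((m - Finsupp.single 0 1 : Fin 2 →₀ ℕ) 0 + 1 : ℕ) : K) = 0 := by exact_mod_cast h3
      rw [Nat.cast_eq_zero] at this
      omega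
  obtain ⟨q, hq⟩ := exists_rename_eq_of_vars_subset_range F (fun _ : Unit => (1 : Fin 2))
    (fun _ _ _ => rfl) (by
      intro i hi
      have hi := Finset.mem_coe.mp hi
      rw [mem_vars_iff_mem_support] at hi
      obtain ⟨m, hm, him⟩ := hi
      fin_cases i
      · exact absurd (hv m hm) (by simpa using him)
      · exact ⟨(), rfl⟩)
  rw [← hq, aeval_rename] at hFz
  have hai : AlgebraicIndependent K (fun _ : Unit => w) :=
    algebraicIndependent_unique_type_iff.mpr hw
  have hq0 : q = 0 := by
    apply (map_eq_zero_iff _ hai).mp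
    rw [← hFz]
    rfl
  apply hF
  rw [← hq, hq0, map_zero]

theorem aux_deg {K A : Type} [Field K] [IsAlgClosed K] [CharZero K] [CommRing A] [IsDomain A]
    [Algebra K A] (htr : Algebra.trdeg K A = 1) {n : ℕ} (x : Fin n → A)
    (hx : Algebra.adjoin K (Set.range x) = ⊤) (s w : A) (hw : Transcendental K w) :
    ∃ F : MvPolynomial (Fin 2) K, Prime F ∧ aeval ![s, w] F = 0 ∧ pderiv 0 F ≠ 0 ∧
      ∃ (u : Fin 2 → K) (γ : K), u 1 • s - u 0 • w - algebraMap K A γ ≠ 0 ∧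
        ∃ T : Finset (Fin 2 → K), T.card = F.totalDegree ∧ ∀ p ∈ T, u 1 * p 0 - u 0 * p 1 = γ ∧
          ∃ φ : A →ₐ[K] K, φ s = p 0 ∧ φ w = p 1 := by
  have hinf := aux_inf htr x hx w hw
  let Φ : MvPolynomial (Fin 2) K →ₐ[K] A := aeval ![s, w]
  have hnai : ¬ AlgebraicIndependent K ![s, w] := by
    intro hai
    have h1 := hai.lift_cardinalMk_le_trdeg
    rw [htr] at h1
    simp at h1
  have hne : RingHom.ker Φ ≠ ⊥ := by
    intro hb
    exact hnai ((RingHom.injective_iff_ker_eq_bot _).mpr hb)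
  obtain ⟨F, hFm, hFp⟩ := (RingHom.ker_isPrime Φ).exists_mem_prime_of_ne_bot hne
  have hF0 : aeval ![s, w] F = 0 := hFm
  have hpt : ∀ (φ : A →ₐ[K] K) (G : MvPolynomial (Fin 2) K),
      eval ![φ s, φ w] G = φ (aeval ![s, w] G) := by
    intro φ G
    have : (φ.comp (aeval ![s, w]) : MvPolynomial (Fin 2) K →ₐ[K] K) = aeval ![φ s, φ w] := by
      apply MvPolynomial.algHom_ext
      intro i
      fin_cases i <;> simp
    have := DFunLike.congr_fun this G
    rw [aeval_eq_eval] at this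
    exact this.symm
  -- any infinite set of points
  have hnotfin : ∀ S : Set (Fin 2 → K), S.Finite → ∃ φ : A →ₐ[K] K, ![φ s, φ w] ∉ S := by
    intro S hS
    by_contra! hcon
    apply hinf
    refine (hS.image fun p => p 1).subset ?_
    rintro c ⟨φ, rfl⟩
    exact ⟨_, hcon φ, rfl⟩
  have hkerF : ∀ G, aeval ![s, w] G = 0 → F ∣ G := by
    intro G hG
    by_contra hnd
    obtain ⟨φ, hφ⟩ := hnotfin _ (aux_finite F G hFp hnd)
    apply hφ
    refine ⟨?_, ?_⟩
    · rw [hpt, hF0, map_zero]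
    · rw [hpt, hG, map_zero]
  obtain ⟨h, hh, hi⟩ := aux_integral htr x w hw
  let H : MvPolynomial (Fin 2) K := Polynomial.aeval (X 1) h
  have hHA : aeval ![s, w] H = Polynomial.aeval w h := by
    rw [← Polynomial.aeval_algHom_apply]; simp
  have hH : ¬ F ∣ H := by
    rintro ⟨q, hq⟩
    have h1 : aeval ![s, w] H = 0 := by rw [hq, map_mul, hF0, zero_mul]
    rw [hHA] at h1
    exact hh ((transcendental_iff.mp hw) h h1)
  obtain ⟨u, γ, hfin, T, hTc, hT⟩ := aux_line F H hFp hH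
  refine ⟨F, hFp, hF0, aux_pderiv_ne s w hw F hFp.ne_zero hF0, u, γ, ?_, T, hTc, ?_⟩
  · intro h0
    obtain ⟨φ, hφ⟩ := hnotfin _ hfin
    apply hφ
    refine ⟨by rw [hpt, hF0, map_zero], ?_⟩
    have := congrArg φ h0
    simp only [map_sub, map_smul, smul_eq_mul, AlgHom.commutes, map_zero,
      Algebra.algebraMap_self, RingHom.id_apply] at this
    simpa using sub_eq_zero.mp this
  · intro p hp
    obtain ⟨hp1, hp2, hp3⟩ := hT p hp
    refine ⟨hp3, ?_⟩
    letI : Algebra (MvPolynomial (Fin 2) K) A := Φ.toRingHom.toAlgebra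
    haveI : IsScalarTower K (MvPolynomial (Fin 2) K) A := IsScalarTower.of_algebraMap_eq fun c =>
      (Φ.commutes c).symm
    obtain ⟨φ, hφ⟩ := aux_lift x hx (aeval p : MvPolynomial (Fin 2) K →ₐ[K] K) (fun r hr => by
        obtain ⟨q, rfl⟩ := hkerF r hr
        rw [map_mul, aeval_eq_eval]
        have : eval p F = 0 := hp1
        change eval p F * _ = 0
        rw [this, zero_mul]) H (by rw [aeval_eq_eval]; exact hp2) (by
        intro i
        obtain ⟨P, hPm, hP⟩ := hi i
        refine ⟨P.map (Polynomial.aeval (X 1 : MvPolynomial (Fin 2) K)).toRingHom, hPm.map _, ?_⟩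
        rw [Polynomial.eval₂_map]
        have hcomp : (algebraMap (MvPolynomial (Fin 2) K) A).comp
            (Polynomial.aeval (X 1 : MvPolynomial (Fin 2) K)).toRingHom
            = (Polynomial.aeval (R := K) w).toRingHom := by
          have : (Φ.comp (Polynomial.aeval (X 1 : MvPolynomial (Fin 2) K))) = Polynomial.aeval w := by
            apply Polynomial.algHom_ext
            rw [AlgHom.comp_apply, Polynomial.aeval_X, Polynomial.aeval_X]
            change aeval ![s, w] (X 1) = w
            simp
          exact congrArg AlgHom.toRingHom this
        rw [hcomp]
        have hs : H • x i = (Polynomial.aeval w h) * x i := by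
          rw [Algebra.smul_def]
          congr 1
        rw [hs]
        exact hP)
    refine ⟨φ, ?_, ?_⟩
    · have := hφ (X 0)
      rw [aeval_X] at this
      rw [← this]
      congr 1
      change s = aeval ![s, w] (X 0)
      simp
    · have := hφ (X 1)
      rw [aeval_X] at this
      rw [← this]
      congr 1
      change w = aeval ![s, w] (X 1)
      simp

theorem aux_krull {K : Type} [Field K] {n : ℕ} (C : Set (Fin n → K)) (h : varDim C = 1) :
    ringKrullDim (MvPolynomial (Fin n) K ⧸ vanishingIdeal K C) = 1 := by
  unfold varDim at h
  generalize ringKrullDim (MvPolynomial (Fin n) K ⧸ vanishingIdeal K C) = d at h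
  induction d using WithBot.recBotCoe with
  | bot => simp at h
  | coe d =>
    rw [WithBot.unbotD_coe] at h
    induction d using ENat.recTopCoe with
    | top => simp at h
    | coe d =>
      rw [ENat.toNat_coe] at h
      rw [h]; rfl

theorem aux_data {K : Type} [Field K] {n : ℕ} (C : Set (Fin n → K))
    (hC : IsIrreducibleVariety C) (h : varDim C = 1) :
    ∃ (A : Type) (_ : CommRing A) (_ : IsDomain A) (_ : Algebra K A)
      (π : MvPolynomial (Fin n) K →ₐ[K] A), (∀ f, π f = 0 ↔ f ∈ vanishingIdeal K C) ∧
      Algebra.adjoin K (Set.range fun i => π (X i)) = ⊤ ∧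
      (∀ p ∈ C, ∃ φ : A →ₐ[K] K, ∀ f, φ (π f) = eval p f) ∧
      (∀ φ : A →ₐ[K] K, (fun i => φ (π (X i))) ∈ C) ∧
      ∃ g : Polynomial K →ₐ[K] A, Function.Injective g ∧ g.Finite := by
  obtain ⟨⟨I, hI⟩, hprime⟩ := hC
  let J := vanishingIdeal K C
  haveI : J.IsPrime := hprime
  have hz : ∀ f, Ideal.Quotient.mkₐ K J f = 0 ↔ f ∈ vanishingIdeal K C :=
    fun f => Ideal.Quotient.eq_zero_iff_mem
  have hs : Function.Surjective (Ideal.Quotient.mkₐ K J) := Ideal.Quotient.mkₐ_surjective K J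
  refine ⟨MvPolynomial (Fin n) K ⧸ J, inferInstance, inferInstance, inferInstance,
    Ideal.Quotient.mkₐ K J, hz, ?_, ?_, ?_, aux_noether (aux_krull C h)⟩
  · rw [show (fun i => Ideal.Quotient.mkₐ K J (X i)) = (Ideal.Quotient.mkₐ K J) ∘ X from rfl,
      Set.range_comp, ← AlgHom.map_adjoin, MvPolynomial.adjoin_range_X, Algebra.map_top]
    exact (AlgHom.range_eq_top _).mpr hs
  · intro p hp
    refine ⟨Ideal.Quotient.liftₐ J (aeval p) ?_, ?_⟩
    · intro f hf
      exact (mem_vanishingIdeal_iff.mp hf) p hp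
    · intro f
      change aeval p f = _
      rw [aeval_eq_eval]
  · intro φ
    have key : ∀ f, aeval (fun i => φ (Ideal.Quotient.mkₐ K J (X i))) f
        = φ (Ideal.Quotient.mkₐ K J f) := by
      intro f
      have : (aeval (fun i => φ (Ideal.Quotient.mkₐ K J (X i))) : MvPolynomial (Fin n) K →ₐ[K] K)
          = φ.comp (Ideal.Quotient.mkₐ K J) := by
        apply MvPolynomial.algHom_ext
        intro i
        rw [aeval_X]; rfl
      rw [this]; rfl
    have hIJ : I ≤ J := by
      intro f hf
      rw [mem_vanishingIdeal_iff]
      intro p hp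
      rw [hI] at hp
      exact hp f hf
    rw [hI]
    intro f hf
    rw [key, (hz f).mpr (hIJ hf), map_zero]

theorem aux_alg_const {K A : Type} [Field K] [IsAlgClosed K] [CommRing A] [IsDomain A]
    [Algebra K A] (w : A) (hw : ¬ Transcendental K w) : ∃ b : K, w = algebraMap K A b := by
  have ha : IsAlgebraic K w := not_not.mp hw
  obtain ⟨q, hq, hqw⟩ := ha
  have hs := IsAlgClosed.splits q
  rw [hs.eq_prod_roots, map_mul, Polynomial.aeval_C, map_multiset_prod, Multiset.map_map,
    mul_eq_zero] at hqw
  rcases hqw with h | h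
  · rw [map_eq_zero_iff _ (algebraMap K A).injective] at h
    exact absurd h (Polynomial.leadingCoeff_ne_zero.mpr hq)
  · rw [Multiset.prod_eq_zero_iff, Multiset.mem_map] at h
    obtain ⟨b, _, hb⟩ := h
    refine ⟨b, ?_⟩
    simpa [sub_eq_zero] using hb

theorem aux_dual {K : Type} [Field K] {n : ℕ} (f : Module.Dual K (Fin n → K)) (p : Fin n → K) :
    f p = ∑ i, f (Pi.single i 1) * p i := by
  conv_lhs => rw [LinearMap.pi_apply_eq_sum_univ f p]
  refine Finset.sum_congr rfl fun i _ => ?_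
  rw [smul_eq_mul, mul_comm]
  congr 2
  funext j
  rw [Pi.single_apply]
  simp only [eq_comm]

theorem aux_hyper {K : Type} [Field K] {n : ℕ} (c : Fin n → K) (hc : c ≠ 0) (b : K) :
    ∃ L : AffineSubspace K (Fin n → K), Module.finrank K L.direction = n - 1 ∧
      ∀ p, p ∈ L ↔ ∑ i, c i * p i = b := by
  classical
  obtain ⟨k, hk⟩ := Function.ne_iff.mp hc
  rw [Pi.zero_apply] at hk
  let f : Module.Dual K (Fin n → K) := ∑ i, c i • LinearMap.proj i
  have hf : ∀ p, f p = ∑ i, c i * p i := by intro p; simp [f]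
  let p0 : Fin n → K := Pi.single k (b / c k)
  have hp0 : f p0 = b := by
    rw [hf, Finset.sum_eq_single k]
    · simp [p0]; field_simp
    · intro i _ hi; simp [p0, hi]
    · simp
  have hf0 : f ≠ 0 := by
    intro h
    have h1 : f (Pi.single k 1) = c k := by
      rw [hf, Finset.sum_eq_single k]
      · simp
      · intro i _ hi; simp [hi]
      · simp
    rw [h] at h1
    exact hk h1.symm
  refine ⟨AffineSubspace.mk' p0 (LinearMap.ker f), ?_, ?_⟩
  · rw [AffineSubspace.direction_mk']
    have := Module.Dual.finrank_ker_add_one_of_ne_zero hf0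
    rw [Module.finrank_fin_fun] at this
    omega
  · intro p
    rw [AffineSubspace.mem_mk', LinearMap.mem_ker, vsub_eq_sub, map_sub, hp0, hf, sub_eq_zero]

theorem aux_hyper_inv {K : Type} [Field K] {n : ℕ} (hn : 1 ≤ n)
    (L : AffineSubspace K (Fin n → K)) (hL : Module.finrank K L.direction = n - 1)
    (p0 : Fin n → K) (hp0 : p0 ∈ L) :
    ∃ (c : Fin n → K) (b : K), ∀ p, p ∈ L ↔ ∑ i, c i * p i = b := by
  have hlt : L.direction < ⊤ := by
    rw [lt_top_iff_ne_top]
    intro h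
    rw [h, finrank_top, Module.finrank_fin_fun] at hL
    omega
  obtain ⟨f, hf0, hf⟩ := Submodule.exists_le_ker_of_lt_top _ hlt
  have hk := Module.Dual.finrank_ker_add_one_of_ne_zero hf0
  rw [Module.finrank_fin_fun] at hk
  have heq : L.direction = LinearMap.ker f := Submodule.eq_of_le_of_finrank_eq hf (by omega)
  refine ⟨fun i => f (Pi.single i 1), f p0, fun p => ?_⟩
  rw [← aux_dual, ← AffineSubspace.vsub_right_mem_direction_iff_mem hp0, heq, LinearMap.mem_ker,
    vsub_eq_sub, map_sub, sub_eq_zero]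

theorem aux_line_sub {K : Type} [Field K] {n : ℕ} (C : Set (Fin n → K))
    (hC : IsAlgebraicSet C) (hinf : C.Infinite) (p0 v : Fin n → K) (hv : v ≠ 0)
    (h : ∀ p ∈ C, ∃ t : K, p = p0 + t • v) : IsLine C := by
  have hp : ∀ t : K, p0 + t • v ∈ C := by
    obtain ⟨I, hI⟩ := hC
    have hI2 := hI
    intro t
    rw [hI]
    intro f hf
    let q : Polynomial K := aeval (fun i => Polynomial.C (p0 i) + Polynomial.C (v i) * Polynomial.X) f
    have hq : ∀ l : K, q.eval l = aeval (p0 + l • v) f := by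
      intro l
      have : ((Polynomial.aeval l).comp (aeval (fun i => Polynomial.C (p0 i) + Polynomial.C (v i) * Polynomial.X) :
          MvPolynomial (Fin n) K →ₐ[K] Polynomial K)) = aeval (p0 + l • v) := by
        apply MvPolynomial.algHom_ext
        intro i
        rw [AlgHom.comp_apply, aeval_X, aeval_X]
        simp only [map_add, map_mul, Polynomial.aeval_C, Polynomial.aeval_X, Pi.add_apply, Pi.smul_apply, smul_eq_mul, Algebra.algebraMap_self, RingHom.id_apply]
        ring
      have := DFunLike.congr_fun this f
      rw [AlgHom.comp_apply, Polynomial.coe_aeval_eq_eval] at this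
      exact this
    have hq0 : q = 0 := by
      apply Polynomial.eq_zero_of_infinite_isRoot
      intro hfin
      apply hinf
      refine (hfin.image fun t => p0 + t • v).subset ?_
      intro p hpC
      obtain ⟨l, rfl⟩ := h p hpC
      refine ⟨l, ?_, rfl⟩
      change q.eval l = 0
      rw [hq]
      rw [hI] at hpC
      exact hpC f hf
    rw [← hq, hq0, Polynomial.eval_zero]
  refine ⟨AffineSubspace.mk' p0 (K ∙ v), ?_, ?_⟩
  · ext p
    rw [SetLike.mem_coe, AffineSubspace.mem_mk', Submodule.mem_span_singleton, vsub_eq_sub]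
    constructor
    · intro hpC
      obtain ⟨t, rfl⟩ := h p hpC
      exact ⟨t, by simp⟩
    · rintro ⟨t, ht⟩
      rw [← add_sub_cancel p0 p, ← ht]
      exact hp t
  · rw [AffineSubspace.direction_mk', finrank_span_singleton hv]

theorem aux_core {K : Type} [Field K] [IsAlgClosed K] [CharZero K]
    {n : ℕ} (C : Set (Fin n → K)) (hC : IsIrreducibleVariety C) (hd : varDim C = 1)
    (hl : ¬ IsLine C) (v : Fin n → K) :
    {p ∈ C | v ∈ tangentSpaceAt C p}.ncard ≤ geomDegree C * (geomDegree C - 1) := by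
  classical
  set P := {p ∈ C | v ∈ tangentSpaceAt C p} with hPdef
  by_cases hPf : P.Finite
  swap
  · rw [Set.Infinite.ncard hPf]; exact Nat.zero_le _
  obtain ⟨A, _, _, _, π, hπ, hgen, hpt, hpt2, g, hg, hgf⟩ := aux_data C hC hd
  have htr := aux_trdeg g hg hgf
  let x : Fin n → A := fun i => π (X i)
  -- C is infinite
  have hCinf : C.Infinite := by
    have hgX : Transcendental K (g Polynomial.X) := by
      rw [transcendental_iff_injective]
      have : Polynomial.aeval (g Polynomial.X) = g := by
        apply Polynomial.algHom_ext; simp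
      rw [this]; exact hg
    intro hfin
    obtain ⟨f, hf⟩ : ∃ f, π f = g Polynomial.X := by
      have h1 : g Polynomial.X ∈ Algebra.adjoin K (Set.range fun i => π (X i)) := by
        rw [hgen]; trivial
      have h2 : Algebra.adjoin K (Set.range fun i => π (X i)) ≤ π.range := by
        rw [Algebra.adjoin_le_iff]
        rintro _ ⟨i, rfl⟩
        exact ⟨X i, rfl⟩
      exact h2 h1
    refine aux_inf htr x hgen _ hgX ((hfin.image fun p => eval p f).subset ?_)
    rintro c ⟨φ, rfl⟩
    refine ⟨_, hpt2 φ, ?_⟩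
    have : (aeval (fun i => φ (π (X i))) : MvPolynomial (Fin n) K →ₐ[K] K) = φ.comp π := by
      apply MvPolynomial.algHom_ext
      intro i
      rw [aeval_X]; rfl
    have := DFunLike.congr_fun this f
    rw [aeval_eq_eval] at this
    rw [← hf]
    exact this
  have hn : 1 ≤ n := by
    by_contra h0
    have : n = 0 := by omega
    subst this
    exact hCinf (Set.toFinite C)
  obtain ⟨p0, hp0⟩ := hCinf.nonempty
  have hphi : ∀ (φ : A →ₐ[K] K) (c : Fin n → K), φ (∑ i, c i • x i) = ∑ i, c i * φ (x i) := by
    intro φ c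
    simp
  -- boundedness
  obtain ⟨N, hN⟩ := aux_bound g hg hgf x
  have hfinite : ∀ (c : Fin n → K) (b : K), ∑ i, c i • x i - algebraMap K A b ≠ 0 →
      ∀ T : Finset (Fin n → K), (∀ p ∈ T, p ∈ C ∧ ∑ i, c i * p i = b) → T.card ≤ N := by
    intro c b hcb T hT
    refine hN c b hcb T fun p hp => ?_
    obtain ⟨hpC, hpb⟩ := hT p hp
    obtain ⟨φ, hφ⟩ := hpt p hpC
    have hφx : ∀ i, φ (x i) = p i := fun i => by rw [hφ, eval_X]
    refine ⟨φ, hφx, ?_⟩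
    rw [map_sub, hphi]
    simp only [hφx]
    rw [hpb, AlgHom.commutes]
    simp
  have hbdd : BddAbove {m | ∃ L : AffineSubspace K (Fin n → K),
      Module.finrank K L.direction = n - varDim C ∧
      (C ∩ (L : Set (Fin n → K))).Finite ∧ (C ∩ (L : Set (Fin n → K))).ncard = m} := by
    refine ⟨N, ?_⟩
    rintro m ⟨L, hL, hfin, rfl⟩
    rcases (C ∩ (L : Set (Fin n → K))).eq_empty_or_nonempty with he | ⟨q, hqC, hqL⟩
    · rw [he, Set.ncard_empty]; exact Nat.zero_le _
    · rw [hd] at hL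
      obtain ⟨c, b, hcb⟩ := aux_hyper_inv hn L hL q hqL
      rw [Set.ncard_eq_toFinset_card _ hfin]
      refine hfinite c b ?_ _ ?_
      · intro h0
        apply hCinf
        refine hfin.subset fun p hp => ⟨hp, ?_⟩
        obtain ⟨φ, hφ⟩ := hpt p hp
        have hφx : ∀ i, φ (x i) = p i := fun i => by rw [hφ, eval_X]
        have := congrArg φ h0
        rw [map_sub, hphi, AlgHom.commutes, map_zero, sub_eq_zero] at this
        simp only [hφx] at this
        exact (hcb p).mpr this
      · intro p hp
        rw [Set.Finite.mem_toFinset] at hp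
        exact ⟨hp.1, (hcb p).mp hp.2⟩
  -- v is nonzero
  have hv : v ≠ 0 := by
    rintro rfl
    apply hCinf
    refine hPf.subset fun p hp => ⟨hp, ?_⟩
    intro f _
    simp
  -- choice of w
  obtain ⟨c, hcv, hw⟩ : ∃ c : Fin n → K, ∑ i, c i * v i = 0 ∧ Transcendental K (∑ i, c i • x i) := by
    by_contra! hcon
    apply hl
    refine aux_line_sub C hC.1 hCinf p0 v hv fun p hp => ?_
    by_contra hno
    have hnm : p - p0 ∉ (K ∙ v) := by
      rw [Submodule.mem_span_singleton]
      rintro ⟨t, ht⟩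
      exact hno ⟨t, by rw [ht]; simp⟩
    obtain ⟨f, hf1, hf2⟩ := Submodule.exists_le_ker_of_notMem hnm
    have hfv : f v = 0 := hf2 (Submodule.mem_span_singleton_self v)
    rw [aux_dual] at hfv
    obtain ⟨b, hb⟩ := aux_alg_const _ (hcon _ hfv)
    have hval : ∀ q ∈ C, f q = b := by
      intro q hq
      obtain ⟨φ, hφ⟩ := hpt q hq
      have hφx : ∀ i, φ (x i) = q i := fun i => by rw [hφ, eval_X]
      have := congrArg φ hb
      rw [hphi, AlgHom.commutes] at this
      simp only [hφx] at this
      rw [aux_dual]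
      exact this
    apply hf1
    rw [map_sub, hval p hp, hval p0 hp0, sub_self]
  -- choice of s
  obtain ⟨c', hcv', hsep⟩ : ∃ c' : Fin n → K, ∑ i, c' i * v i ≠ 0 ∧
      ∀ p ∈ P, ∀ q ∈ P, ∑ i, c' i * p i = ∑ i, c' i * q i → p = q := by
    haveI : Finite P := hPf
    let V : Option {z : P × P // z.1 ≠ z.2} → (Fin n → K) := fun o =>
      match o with
      | none => v
      | some z => (z.1.1 : Fin n → K) - z.1.2
    obtain ⟨f, hf⟩ := Module.exists_dual_forall_apply_ne_zero (K := K) V (by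
      rintro (_ | ⟨z, hz⟩)
      · exact hv
      · exact fun h => hz (Subtype.ext (sub_eq_zero.mp h)))
    refine ⟨fun i => f (Pi.single i 1), ?_, ?_⟩
    · rw [← aux_dual]; exact hf none
    · intro p hp q hq hpq
      rw [← aux_dual, ← aux_dual] at hpq
      by_contra hne
      apply hf (some ⟨(⟨p, hp⟩, ⟨q, hq⟩), fun h => hne (congrArg Subtype.val h)⟩)
      change f (p - q) = 0
      rw [map_sub, hpq, sub_self]
  obtain ⟨F, hFp, hF0, hFd, u, γ, hη, T, hTc, hT⟩ :=
    aux_deg htr x hgen (∑ i, c' i • x i) (∑ i, c i • x i) hw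
  have hd1 := aux_prime_deg F hFp
  -- degree bound
  have hdeg : F.totalDegree ≤ geomDegree C := by
    let e : Fin n → K := fun i => u 1 * c' i - u 0 * c i
    have he : ∑ i, e i • x i = u 1 • (∑ i, c' i • x i) - u 0 • ∑ i, c i • x i := by
      simp only [e, Finset.smul_sum, ← Finset.sum_sub_distrib, sub_smul, smul_smul]
    rw [← he] at hη
    have hTe : ∀ p ∈ T, ∃ q ∈ C, ∑ i, e i * q i = γ ∧
        p = ![∑ i, c' i * q i, ∑ i, c i * q i] := by
      intro p hp
      obtain ⟨h1, φ, h2, h3⟩ := hT p hp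
      refine ⟨_, hpt2 φ, ?_, ?_⟩
      · change ∑ i, e i * φ (x i) = γ
        rw [← hphi, he, map_sub, map_smul, map_smul, h2, h3]
        exact h1
      · rw [hphi] at h2 h3
        ext j
        fin_cases j
        · exact h2.symm
        · exact h3.symm
    have he0 : e ≠ 0 := by
      intro h0
      apply hη
      obtain ⟨p, hp⟩ : T.Nonempty := by rw [← Finset.card_pos]; omega
      obtain ⟨q, _, hq, _⟩ := hTe p hp
      rw [h0] at hq
      have : γ = 0 := by rw [← hq]; simp
      rw [h0, this]; simp
    obtain ⟨L, hL, hLm⟩ := aux_hyper e he0 γ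
    have hfin : (C ∩ (L : Set (Fin n → K))).Finite := by
      by_contra hinf
      obtain ⟨t, ht, htc⟩ := (show Set.Infinite _ from hinf).exists_subset_card_eq (N + 1)
      have := hfinite e γ hη t fun p hp => ⟨(ht hp).1, (hLm p).mp (ht hp).2⟩
      omega
    have h1 : (C ∩ (L : Set (Fin n → K))).ncard ≤ geomDegree C :=
      le_csSup hbdd ⟨L, by rw [hd]; exact hL, hfin, rfl⟩
    refine le_trans ?_ h1
    rw [← hTc, Set.ncard_eq_toFinset_card _ hfin]
    refine le_trans (Finset.card_le_card (t := hfin.toFinset.image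
      fun q => ![∑ i, c' i * q i, ∑ i, c i * q i]) ?_) Finset.card_image_le
    intro p hp
    obtain ⟨q, hq, hq1, rfl⟩ := hTe p hp
    refine Finset.mem_image.mpr ⟨q, ?_, rfl⟩
    rw [Set.Finite.mem_toFinset]
    exact ⟨hq, (hLm q).mpr hq1⟩
  -- Bezout bound
  let y : Fin 2 → MvPolynomial (Fin n) K := ![∑ i, c' i • X i, ∑ i, c i • X i]
  have hyI : aeval y F ∈ vanishingIdeal K C := by
    rw [← hπ]
    have : π.comp (aeval y) = aeval ![∑ i, c' i • x i, ∑ i, c i • x i] := by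
      apply MvPolynomial.algHom_ext
      intro j
      rw [AlgHom.comp_apply, aeval_X, aeval_X]
      fin_cases j <;> simp [y, x]
    have := DFunLike.congr_fun this F
    rw [hF0] at this
    exact this
  have hyp : ∀ (p : Fin n → K) (G : MvPolynomial (Fin 2) K),
      eval p (aeval y G) = eval ![∑ i, c' i * p i, ∑ i, c i * p i] G := by
    intro p G
    have : (aeval p : MvPolynomial (Fin n) K →ₐ[K] K).comp (aeval y)
        = aeval ![∑ i, c' i * p i, ∑ i, c i * p i] := by
      apply MvPolynomial.algHom_ext
      intro j
      rw [AlgHom.comp_apply, aeval_X, aeval_X]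
      fin_cases j <;> simp [y]
    have := DFunLike.congr_fun this G
    rw [AlgHom.comp_apply, aeval_eq_eval, aeval_eq_eval] at this
    exact this
  have hlin : ∀ (a : Fin n → K) (p : Fin n → K) (i : Fin n),
      eval p (pderiv i (∑ k, a k • X k : MvPolynomial (Fin n) K)) = a i := by
    intro a p i
    rw [map_sum, map_sum, Finset.sum_eq_single i]
    · simp [smul_eval]
    · intro k _ hk
      simp [smul_eval, pderiv_X, Pi.single_apply, hk]
    · simp
  have hvan : ∀ p ∈ P, eval ![∑ i, c' i * p i, ∑ i, c i * p i] (pderiv 0 F) = 0 := by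
    rintro p ⟨_, hpv⟩
    have h1 := hpv _ hyI
    simp only [aux_chain, Fin.sum_univ_two, map_add, map_mul, hyp] at h1
    have h2 : ∀ i, eval p (pderiv i (y 0)) = c' i := hlin c' p
    have h3 : ∀ i, eval p (pderiv i (y 1)) = c i := hlin c p
    simp only [h2, h3] at h1
    set a := eval ![∑ i, c' i * p i, ∑ i, c i * p i] (pderiv 0 F)
    set b := eval ![∑ i, c' i * p i, ∑ i, c i * p i] (pderiv 1 F)
    have h4 : ∑ i, (a * c' i + b * c i) * v i = a * (∑ i, c' i * v i) + b * ∑ i, c i * v i := by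
      rw [Finset.mul_sum, Finset.mul_sum, ← Finset.sum_add_distrib]
      exact Finset.sum_congr rfl fun i _ => by ring
    rw [h4, hcv, mul_zero, add_zero] at h1
    exact (mul_eq_zero.mp h1).resolve_right hcv'
  have hGd := aux_pderiv_deg F 0
  have hbez := aux_bezout F (pderiv 0 F) hFp (aux_dvd_deg F _ hFp hFd (by omega))
    (hPf.toFinset.image fun p => ![∑ i, c' i * p i, ∑ i, c i * p i]) (by
      intro z hz
      obtain ⟨p, hp, rfl⟩ := Finset.mem_image.mp hz
      rw [Set.Finite.mem_toFinset] at hp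
      refine ⟨?_, hvan p hp⟩
      rw [← hyp]
      exact (mem_vanishingIdeal_iff.mp hyI) p hp.1)
  rw [Finset.card_image_of_injOn] at hbez
  · rw [Set.ncard_eq_toFinset_card _ hPf]
    refine hbez.trans ?_
    exact Nat.mul_le_mul hdeg (by omega)
  · intro p hp q hq hpq
    rw [Finset.mem_coe, Set.Finite.mem_toFinset] at hp hq
    exact hsep p hp q hq (congrFun hpq 0)

/-- For a smooth irreducible curve `C ⊆ A^n` which is not a line,
`ω(C) ≤ deg(C)(deg(C) − 1)`. -/
theorem omegaCurve_le {K : Type} [Field K] [IsAlgClosed K] [CharZero K]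
    {n : ℕ} (C : Set (Fin n → K)) (hC : IsSmoothCurve C) (hl : ¬ IsLine C) :
    omegaCurve C ≤ geomDegree C * (geomDegree C - 1) := by
  classical
  unfold omegaCurve
  rw [if_neg hl]
  set S := {m | ∃ Z : Set (Fin n → K), IsAlgebraicSet Z ∧ ¬ tangentialVariety C ⊆ Z ∧
    ∀ v ∈ tangentialVariety C \ Z,
      {z ∈ tangentBundle C | sndProj z = v}.ncard = m} with hS
  rcases S.eq_empty_or_nonempty with he | hne
  · rw [he, Nat.sInf_empty]; exact Nat.zero_le _
  · obtain ⟨Z, _, hZ, hv⟩ := Nat.sInf_mem hne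
    obtain ⟨v, hv1, hv2⟩ := Set.not_subset.mp hZ
    rw [← hv v ⟨hv1, hv2⟩]
    refine le_trans (le_of_eq ?_) (aux_core C hC.1 hC.2.1 hl v)
    rw [← Set.ncard_image_of_injOn (f := fstProj)
      (s := {z ∈ tangentBundle C | sndProj z = v})]
    · congr 1
      ext p
      constructor
      · rintro ⟨z, ⟨⟨h1, h2⟩, rfl⟩, rfl⟩
        exact ⟨h1, h2⟩
      · rintro ⟨h1, h2⟩
        have e1 : fstProj (Fin.append p v) = p := by
          funext i; simp [fstProj]
        have e2 : sndProj (Fin.append p v) = v := by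
          funext i; exact Fin.append_right p v i
        refine ⟨Fin.append p v, ⟨⟨?_, ?_⟩, e2⟩, e1⟩
        · rw [e1]; exact h1
        · rw [e1, e2]; exact h2
    · rintro z ⟨_, hz⟩ z' ⟨_, hz'⟩ h
      funext i
      induction i using Fin.addCases with
      | left i => exact congrFun h i
      | right i => exact congrFun (hz.trans hz'.symm) i
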